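/- Assume moreover that s < s_c := 3/2 − 2/(p−1), and set δ₀ := ((3/2 − s)(p−1) − 2)/2 > 0. Then there exist C > 0 and N ≥ 2 such that for every real n ≥ N, every ε > 0, every t ∈ [0, t_n], and every pair of multi-indices α, α' ∈ ℕ³ with |α| = 2 and |α'| = 4, one has n^s ‖∂^α v_nᵉ(t, ·)‖_{L²(ℝ³)} + n^{s−2} ‖∂^{α'} v_nᵉ(t, ·)‖_{L²(ℝ³)} ≤ C n^{(3/2−s)(p−1) − δ₀}. -/

import Mathlib

open MeasureTheory Real ENNReal

noncomputable section

abbrev E3 := EuclideanSpace ℝ (Fin 3)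

/-- Partial derivative in the `i`-th coordinate direction. -/
def pd {F : Type} [NormedAddCommGroup F] [NormedSpace ℝ F] (i : Fin 3) (f : E3 → F) : E3 → F :=
  fun x => fderiv ℝ f x (EuclideanSpace.single i 1)

/-- Iterated partial derivative associated with the multi-index `α : Fin 3 → ℕ`. -/
def pda {F : Type} [NormedAddCommGroup F] [NormedSpace ℝ F] (α : Fin 3 → ℕ) (f : E3 → F) :
    E3 → F :=
  (pd 0)^[α 0] ((pd 1)^[α 1] ((pd 2)^[α 2] f))

/-- The approximate identity `ρ_ε`. -/
def rhoeps (ρ : E3 → ℝ) (ε : ℝ) : E3 → ℝ := fun x => (ε ^ 3)⁻¹ * ρ (ε⁻¹ • x)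

def kap (γ n : ℝ) : ℝ := Real.log n ^ (-γ)

def lam (p : ℕ) (s γ n : ℝ) : ℝ :=
  kap γ n ^ (((p : ℝ) - 1) / 2) * n ^ (((3 : ℝ) / 2 - s) * ((p : ℝ) - 1) / 2)

/-- The bubble `v_n(0,·)`. -/
def bubble (s γ : ℝ) (φ : E3 → ℝ) (n : ℝ) : E3 → ℝ :=
  fun x => kap γ n * n ^ ((3 : ℝ) / 2 - s) * φ (n • x)

/-- Convolution of two real valued functions on `ℝ³`. -/
def convR (f g : E3 → ℝ) : E3 → ℝ :=
  MeasureTheory.convolution f g (ContinuousLinearMap.lsmul ℝ ℝ) volume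

/-- The regularized bubble `v_nᵉ(0,·) = ρ_ε ∗ v_n(0,·)`. -/
def bubbleE (s γ : ℝ) (ρ φ : E3 → ℝ) (n ε : ℝ) : E3 → ℝ :=
  convR (rhoeps ρ ε) (bubble s γ φ n)

/-- The ODE profile `v_nᵉ(t,x) = v_nᵉ(0,x) exp(iσt |v_nᵉ(0,x)|^{p-1})`. -/
def vE (σ : ℝ) (p : ℕ) (s γ : ℝ) (ρ φ : E3 → ℝ) (n ε t : ℝ) : E3 → ℂ :=
  fun x => (bubbleE s γ ρ φ n ε x : ℂ) *
    Complex.exp (Complex.I * σ * t * ((|bubbleE s γ ρ φ n ε x| ^ ((p : ℝ) - 1) : ℝ) : ℂ))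


/-- The inflation time `t_n := λ_n⁻² (log n)^{(β-γ)(p-1)}`. -/
def tinf (p : ℕ) (s γ β n : ℝ) : ℝ :=
  (lam p s γ n ^ 2)⁻¹ * Real.log n ^ ((β - γ) * ((p : ℝ) - 1))

section DerivativeBounds

variable {E : Type*} [NormedAddCommGroup E] [NormedSpace ℝ E]
  {𝔸 : Type*} [NormedRing 𝔸] [NormedAlgebra ℝ 𝔸]

/-- Geometric bounds on the derivatives at a point are stable under products. -/
theorem norm_iteratedFDeriv_mul_le_geometric {f g : E → 𝔸} (hf : ContDiff ℝ (⊤ : ℕ∞) f)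
    (hg : ContDiff ℝ (⊤ : ℕ∞) g) {x : E} {k : ℕ} {A B L M : ℝ} (hA : 0 ≤ A) (hL : 0 ≤ L)
    (hfx : ∀ i ≤ k, ‖iteratedFDeriv ℝ i f x‖ ≤ A * L ^ i)
    (hgx : ∀ i ≤ k, ‖iteratedFDeriv ℝ i g x‖ ≤ B * M ^ i) :
    ‖iteratedFDeriv ℝ k (fun y => f y * g y) x‖ ≤ A * B * (L + M) ^ k := by
  refine (norm_iteratedFDeriv_mul_le hf hg x (by exact_mod_cast le_top)).trans ?_
  rw [add_pow, Finset.mul_sum]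
  refine Finset.sum_le_sum fun i hi => ?_
  have hik : i ≤ k := Nat.lt_succ_iff.mp (Finset.mem_range.mp hi)
  calc (k.choose i : ℝ) * ‖iteratedFDeriv ℝ i f x‖ * ‖iteratedFDeriv ℝ (k - i) g x‖
      ≤ (k.choose i : ℝ) * (A * L ^ i) * (B * M ^ (k - i)) := by
        gcongr
        · exact hfx i hik
        · exact hgx (k - i) (Nat.sub_le _ _)
    _ = A * B * (L ^ i * M ^ (k - i) * (k.choose i : ℝ)) := by ring

theorem norm_iteratedFDeriv_pow_le_geometric {u : E → ℝ} (hu : ContDiff ℝ (⊤ : ℕ∞) u) {x : E}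
    {N : ℕ} {A M : ℝ} (hA : 0 ≤ A) (hM : 0 ≤ M)
    (hux : ∀ i ≤ N, ‖iteratedFDeriv ℝ i u x‖ ≤ A * M ^ i) (m : ℕ) :
    ∀ k ≤ N, ‖iteratedFDeriv ℝ k (fun y => u y ^ m) x‖ ≤ A ^ m * (m * M) ^ k := by
  induction m with
  | zero =>
    intro k _
    rcases Nat.eq_zero_or_pos k with rfl | hk
    · simp
    · simp [iteratedFDeriv_const_of_ne hk.ne', hk.ne']
  | succ m ih =>
    intro k hk
    simp_rw [pow_succ]
    refine (norm_iteratedFDeriv_mul_le_geometric (hu.pow m) hu (pow_nonneg hA m)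
      (by positivity) (fun i hi => ih i (hi.trans hk)) fun i hi => hux i (hi.trans hk)).trans_eq ?_
    push_cast
    ring

theorem iteratedDeriv_cexp_ofReal_mul_I (k : ℕ) :
    iteratedDeriv k (fun θ : ℝ => Complex.exp (θ * Complex.I)) =
      fun θ : ℝ => Complex.I ^ k * Complex.exp (θ * Complex.I) := by
  induction k with
  | zero => simp
  | succ k ih =>
    rw [iteratedDeriv_succ, ih]
    funext θ
    have h : HasDerivAt (fun θ : ℝ => Complex.I ^ k * Complex.exp (θ * Complex.I))
        (Complex.I ^ k * (Complex.exp (θ * Complex.I) * (1 * Complex.I))) θ :=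
      (((Complex.ofRealCLM.hasDerivAt (x := θ)).mul_const Complex.I).cexp).const_mul _
    rw [h.deriv]
    ring

theorem contDiff_cexp_ofReal_mul_I {n : WithTop ℕ∞} :
    ContDiff ℝ n (fun θ : ℝ => Complex.exp (θ * Complex.I)) :=
  (Complex.ofRealCLM.contDiff.mul contDiff_const).cexp

/-- Derivative bounds for `u · exp(i τ u^m)`, with constant factor `W` for the amplitude. -/
theorem norm_iteratedFDeriv_mul_cexp_pow_le {u : E → ℝ} (hu : ContDiff ℝ (⊤ : ℕ∞) u) {x : E}
    {N : ℕ} {A W M τ : ℝ} (hA : 0 ≤ A) (hW : 0 ≤ W) (hM : 0 ≤ M)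
    (hux : ∀ i ≤ N, ‖iteratedFDeriv ℝ i u x‖ ≤ A * M ^ i)
    (hux' : ∀ i ≤ N, ‖iteratedFDeriv ℝ i u x‖ ≤ W * M ^ i) (m : ℕ) {k : ℕ} (hk : k ≤ N) :
    ‖iteratedFDeriv ℝ k
        (fun y => (u y : ℂ) * Complex.exp (((τ * u y ^ m : ℝ) : ℂ) * Complex.I)) x‖ ≤
      W * (N.factorial : ℝ) * (M + (1 + |τ| * A ^ m) * (m * M)) ^ k := by
  have hh : ContDiff ℝ (⊤ : ℕ∞) (fun y => τ * u y ^ m) := contDiff_const.mul (hu.pow m)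
  have hU : ContDiff ℝ (⊤ : ℕ∞) (fun y => (u y : ℂ)) := Complex.ofRealCLM.contDiff.comp hu
  have hhx : ∀ i, 1 ≤ i → i ≤ N → ‖iteratedFDeriv ℝ i (fun y => τ * u y ^ m) x‖ ≤
      ((1 + |τ| * A ^ m) * (m * M)) ^ i := by
    intro i hi hiN
    have h1 : iteratedFDeriv ℝ i (fun y => τ * u y ^ m) x =
        τ • iteratedFDeriv ℝ i (fun y => u y ^ m) x :=
      iteratedFDeriv_const_smul_apply' (a := τ)
        ((hu.pow m).contDiffAt.of_le (by exact_mod_cast le_top))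
    rw [h1, norm_smul, Real.norm_eq_abs, mul_pow]
    have h0 : 0 ≤ |τ| * A ^ m := by positivity
    calc |τ| * ‖iteratedFDeriv ℝ i (fun y => u y ^ m) x‖
        ≤ |τ| * (A ^ m * (m * M) ^ i) := by
          gcongr
          exact norm_iteratedFDeriv_pow_le_geometric hu hA hM hux m i hiN
      _ = (|τ| * A ^ m) * (m * M) ^ i := by ring
      _ ≤ (1 + |τ| * A ^ m) ^ i * (m * M) ^ i := by
          gcongr
          calc |τ| * A ^ m ≤ 1 + |τ| * A ^ m := by linarith
            _ ≤ (1 + |τ| * A ^ m) ^ i := le_self_pow₀ (by linarith) (by omega)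
  refine norm_iteratedFDeriv_mul_le_geometric hU (contDiff_cexp_ofReal_mul_I.comp hh)
    hW hM (fun i hi => ?_) fun i hi => ?_
  · have h2 := Complex.ofRealLI.norm_iteratedFDeriv_comp_left (i := i) (x := x)
      hu.contDiffAt (by exact_mod_cast le_top)
    exact h2.trans_le (hux' i (hi.trans hk))
  · refine (norm_iteratedFDeriv_comp_le (C := 1) contDiff_cexp_ofReal_mul_I hh
      (by exact_mod_cast le_top) x (fun j _ => ?_)
      fun j hj hji => hhx j hj (hji.trans (hi.trans hk))).trans ?_
    · rw [norm_iteratedFDeriv_eq_norm_iteratedDeriv, iteratedDeriv_cexp_ofReal_mul_I]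
      rw [norm_mul, norm_pow, Complex.norm_I, one_pow, Complex.norm_exp_ofReal_mul_I, one_mul]
    · rw [mul_one]
      have : (i.factorial : ℝ) ≤ N.factorial := by
        exact_mod_cast Nat.factorial_le (hi.trans hk)
      gcongr

end DerivativeBounds

section PartialDerivatives

variable {F : Type} [NormedAddCommGroup F] [NormedSpace ℝ F]

theorem ContDiff.pd {f : E3 → F} (hf : ContDiff ℝ (⊤ : ℕ∞) f) (i : Fin 3) :
    ContDiff ℝ (⊤ : ℕ∞) (pd i f) :=
  (hf.fderiv_right (m := (⊤ : ℕ∞)) (by norm_cast)).clm_apply contDiff_const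

theorem norm_iteratedFDeriv_pd_le {f : E3 → F} (hf : ContDiff ℝ (⊤ : ℕ∞) f) (i : Fin 3) (j : ℕ)
    (x : E3) : ‖iteratedFDeriv ℝ j (pd i f) x‖ ≤ ‖iteratedFDeriv ℝ (j + 1) f x‖ := by
  have h : ContDiff ℝ (⊤ : ℕ∞) (fderiv ℝ f) := hf.fderiv_right (by norm_cast)
  have := norm_iteratedFDeriv_clm_apply_const (c := (EuclideanSpace.single i (1 : ℝ) : E3))
    (h.contDiffAt (x := x)) (n := j) (by exact_mod_cast le_top)
  rw [norm_iteratedFDeriv_fderiv] at this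
  exact this.trans_eq (by simp)

theorem ContDiff.iterate_pd {f : E3 → F} (hf : ContDiff ℝ (⊤ : ℕ∞) f) (i : Fin 3) (k : ℕ) :
    ContDiff ℝ (⊤ : ℕ∞) ((_root_.pd i)^[k] f) := by
  induction k with
  | zero => exact hf
  | succ k ih =>
    rw [Function.iterate_succ_apply']
    exact ih.pd i

theorem norm_iteratedFDeriv_iterate_pd_le {f : E3 → F} (hf : ContDiff ℝ (⊤ : ℕ∞) f) (i : Fin 3)
    (k j : ℕ) (x : E3) :
    ‖iteratedFDeriv ℝ j ((pd i)^[k] f) x‖ ≤ ‖iteratedFDeriv ℝ (k + j) f x‖ := by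
  induction k generalizing j with
  | zero => rw [Nat.zero_add, Function.iterate_zero_apply]
  | succ k ih =>
    rw [Function.iterate_succ_apply']
    refine (norm_iteratedFDeriv_pd_le (hf.iterate_pd i k) i j x).trans ((ih (j + 1)).trans_eq ?_)
    rw [show k + (j + 1) = k + 1 + j by ring]

theorem norm_pda_le {f : E3 → F} (hf : ContDiff ℝ (⊤ : ℕ∞) f) (α : Fin 3 → ℕ) (x : E3) :
    ‖pda α f x‖ ≤ ‖iteratedFDeriv ℝ (α 0 + α 1 + α 2) f x‖ := by
  have h2 := hf.iterate_pd 2 (α 2)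
  rw [pda, ← norm_iteratedFDeriv_zero (𝕜 := ℝ)]
  refine (norm_iteratedFDeriv_iterate_pd_le (h2.iterate_pd 1 (α 1)) 0 _ _ x).trans ?_
  refine (norm_iteratedFDeriv_iterate_pd_le h2 1 _ _ x).trans ?_
  refine (norm_iteratedFDeriv_iterate_pd_le hf 2 _ _ x).trans_eq ?_
  rw [show α 2 + (α 1 + (α 0 + 0)) = α 0 + α 1 + α 2 by ring]

end PartialDerivatives

section Convolution

/-- The mass which a translate of the kernel `r` puts on the set `B`. -/
def kernelMass (r : E3 → ℝ) (B : Set E3) : E3 → ℝ := convR r (B.indicator 1)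

theorem integrable_mul_indicator_sub {r : E3 → ℝ} (hr : Integrable r) {B : Set E3}
    (hB : MeasurableSet B) (x : E3) :
    Integrable fun t => r t * B.indicator (1 : E3 → ℝ) (x - t) := by
  have h : (fun t => r t * B.indicator (1 : E3 → ℝ) (x - t)) =
      ((fun t => x - t) ⁻¹' B).indicator r := by
    funext t
    by_cases ht : x - t ∈ B <;> simp [ht]
  rw [h]
  exact hr.indicator (hB.preimage (by fun_prop))

theorem kernelMass_nonneg {r : E3 → ℝ} (hr0 : ∀ x, 0 ≤ r x) (B : Set E3) (x : E3) :
    0 ≤ kernelMass r B x :=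
  integral_nonneg fun t => mul_nonneg (hr0 t) (Set.indicator_nonneg (by simp) _)

theorem kernelMass_le_integral {r : E3 → ℝ} (hr : Integrable r) (hr0 : ∀ x, 0 ≤ r x) {B : Set E3}
    (hB : MeasurableSet B) (x : E3) : kernelMass r B x ≤ ∫ y, r y := by
  refine integral_mono (integrable_mul_indicator_sub hr hB x) hr fun t => ?_
  by_cases ht : x - t ∈ B <;> simp [ht, hr0]

theorem integrable_indicator_one {B : Set E3} (hB : MeasurableSet B) (hB' : volume B ≠ ∞) :
    Integrable (B.indicator (1 : E3 → ℝ)) :=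
  (integrable_indicator_iff hB).2 (integrableOn_const hB')

theorem integrable_kernelMass {r : E3 → ℝ} (hr : Integrable r) {B : Set E3}
    (hB : MeasurableSet B) (hB' : volume B ≠ ∞) : Integrable (kernelMass r B) :=
  hr.integrable_convolution _ (integrable_indicator_one hB hB')

theorem integral_kernelMass {r : E3 → ℝ} (hr : Integrable r) {B : Set E3}
    (hB : MeasurableSet B) (hB' : volume B ≠ ∞) :
    ∫ x, kernelMass r B x = (∫ x, r x) * volume.real B := by
  refine (integral_convolution _ hr (integrable_indicator_one hB hB')).trans ?_
  rw [integral_indicator_one hB]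
  simp

/-- A derivative of `g` supported in `B` and bounded by `M` gives a derivative of `r ⋆ g` bounded
by `M` times the local mass of `r`. -/
theorem norm_iteratedFDeriv_convolution_le {r : E3 → ℝ} (hr : Integrable r)
    (hr0 : ∀ x, 0 ≤ r x) {B : Set E3} (hB : MeasurableSet B) {M : ℝ} (i : ℕ) :
    ∀ {F : Type} [NormedAddCommGroup F] [NormedSpace ℝ F] {g : E3 → F},
      ContDiff ℝ (⊤ : ℕ∞) g → HasCompactSupport g →
      (∀ z, ‖iteratedFDeriv ℝ i g z‖ ≤ M * B.indicator (1 : E3 → ℝ) z) → ∀ x,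
      ‖iteratedFDeriv ℝ i
        (MeasureTheory.convolution r g (ContinuousLinearMap.lsmul ℝ ℝ) volume) x‖ ≤
          M * kernelMass r B x := by
  induction i with
  | zero =>
    intro F _ _ g hg hgs hM x
    simp only [norm_iteratedFDeriv_zero] at hM ⊢
    have h : M * kernelMass r B x = ∫ t, M * (r t * B.indicator (1 : E3 → ℝ) (x - t)) := by
      rw [integral_const_mul]
      rfl
    rw [h]
    refine norm_integral_le_of_norm_le ((integrable_mul_indicator_sub hr hB x).const_mul M)
      (Filter.Eventually.of_forall fun t => ?_)
    have h1 : ‖r t • g (x - t)‖ ≤ r t * (M * B.indicator (1 : E3 → ℝ) (x - t)) := by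
      rw [norm_smul, Real.norm_of_nonneg (hr0 t)]
      exact mul_le_mul_of_nonneg_left (hM _) (hr0 t)
    calc _ ≤ _ := h1
      _ = _ := by ring
  | succ i ih =>
    intro F _ _ g hg hgs hM x
    have h : fderiv ℝ (MeasureTheory.convolution r g (ContinuousLinearMap.lsmul ℝ ℝ) volume) =
        MeasureTheory.convolution r (fderiv ℝ g) (ContinuousLinearMap.lsmul ℝ ℝ) volume := by
      funext y
      exact (hgs.hasFDerivAt_convolution_right _ hr.locallyIntegrable
        (hg.of_le (by exact_mod_cast le_top)) y).fderiv
    rw [← norm_iteratedFDeriv_fderiv, h]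
    refine ih (hg.fderiv_right (by norm_cast)) (hgs.fderiv ℝ) (fun z => ?_) x
    rw [norm_iteratedFDeriv_fderiv]
    exact hM z

end Convolution

/-- `L²` bound for a function dominated by a multiple of a weight `w` with `0 ≤ w ≤ 1`. -/
theorem eLpNorm_two_le_of_norm_le_mul {X F : Type*} [MeasurableSpace X] {μ : Measure X}
    [NormedAddCommGroup F] {f : X → F} {w : X → ℝ} {c : ℝ} (hc : 0 ≤ c) (hw : Integrable w μ)
    (hw0 : ∀ x, 0 ≤ w x) (hw1 : ∀ x, w x ≤ 1) (hf : ∀ x, ‖f x‖ ≤ c * w x) :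
    eLpNorm f 2 μ ≤ ENNReal.ofReal (c * √(∫ x, w x ∂μ)) := by
  have hI : 0 ≤ ∫ x, w x ∂μ := integral_nonneg hw0
  rw [eLpNorm_eq_lintegral_rpow_enorm_toReal (by norm_num) (by norm_num)]
  have h1 : ∫⁻ x, ‖f x‖ₑ ^ (2 : ℝ≥0∞).toReal ∂μ ≤ ENNReal.ofReal (c ^ 2 * ∫ x, w x ∂μ) := by
    rw [← integral_const_mul, ofReal_integral_eq_lintegral_ofReal (hw.const_mul _)
      (Filter.Eventually.of_forall fun x => mul_nonneg (sq_nonneg c) (hw0 x))]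
    refine lintegral_mono fun x => ?_
    rw [← ofReal_norm, ENNReal.toReal_ofNat,
      ENNReal.ofReal_rpow_of_nonneg (norm_nonneg _) (by norm_num)]
    refine ENNReal.ofReal_le_ofReal ?_
    rw [Real.rpow_ofNat]
    calc ‖f x‖ ^ 2 ≤ (c * w x) ^ 2 := by gcongr; exact hf x
      _ = c ^ 2 * (w x * w x) := by ring
      _ ≤ c ^ 2 * (w x * 1) := by gcongr; exacts [hw0 x, hw1 x]
      _ = c ^ 2 * w x := by ring
  calc _ ≤ ENNReal.ofReal (c ^ 2 * ∫ x, w x ∂μ) ^ (1 / (2 : ℝ≥0∞).toReal) := by gcongr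
    _ = _ := by
      rw [ENNReal.toReal_ofNat, ENNReal.ofReal_rpow_of_nonneg (by positivity) (by norm_num),
        ← Real.sqrt_eq_rpow, Real.sqrt_mul (sq_nonneg c), Real.sqrt_sq hc]

section Bubbles

theorem rhoeps_nonneg {ρ : E3 → ℝ} (hρ : ∀ x, 0 ≤ ρ x) {ε : ℝ} (hε : 0 < ε) (x : E3) :
    0 ≤ rhoeps ρ ε x :=
  mul_nonneg (by positivity) (hρ _)

theorem integrable_rhoeps {ρ : E3 → ℝ} (hρ : Integrable ρ) {ε : ℝ} (hε : 0 < ε) :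
    Integrable (rhoeps ρ ε) :=
  (hρ.comp_smul (inv_ne_zero hε.ne')).const_mul _

theorem integral_rhoeps (ρ : E3 → ℝ) {ε : ℝ} (hε : 0 < ε) : ∫ x, rhoeps ρ ε x = ∫ x, ρ x := by
  simp only [rhoeps]
  rw [integral_const_mul, Measure.integral_comp_inv_smul_of_nonneg _ _ hε.le,
    finrank_euclideanSpace_fin, smul_eq_mul, inv_mul_cancel_left₀ (by positivity)]

/-- A common geometric bound for the derivatives of a compactly supported profile. -/
theorem exists_norm_iteratedFDeriv_le_pow {φ : E3 → ℝ} (hφ : ContDiff ℝ (⊤ : ℕ∞) φ)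
    (hφ_supp : HasCompactSupport φ) (hφ_le : ∀ x, ‖φ x‖ ≤ 1) (N : ℕ) :
    ∃ K : ℝ, 1 ≤ K ∧ ∀ i ≤ N, ∀ x, ‖iteratedFDeriv ℝ i φ x‖ ≤ K ^ i := by
  have h : ∀ i : ℕ, ∃ C, ∀ x, ‖iteratedFDeriv ℝ i φ x‖ ≤ C := fun i =>
    (hφ_supp.iteratedFDeriv i).exists_bound_of_continuous
      (hφ.continuous_iteratedFDeriv (by exact_mod_cast le_top))
  choose C hC using h
  have hC0 : ∀ i, 0 ≤ C i := fun i => (norm_nonneg _).trans (hC i 0)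
  have hK : 1 ≤ 1 + ∑ i ∈ Finset.range (N + 1), C i :=
    le_add_of_nonneg_right (Finset.sum_nonneg fun i _ => hC0 i)
  refine ⟨1 + ∑ i ∈ Finset.range (N + 1), C i, hK, fun i hi x => ?_⟩
  rcases Nat.eq_zero_or_pos i with rfl | hi0
  · simpa using hφ_le x
  · calc ‖iteratedFDeriv ℝ i φ x‖ ≤ C i := hC i x
      _ ≤ ∑ i ∈ Finset.range (N + 1), C i :=
        Finset.single_le_sum (fun j _ => hC0 j) (Finset.mem_range.2 (by omega))
      _ ≤ 1 + ∑ i ∈ Finset.range (N + 1), C i := by linarith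
      _ ≤ _ := le_self_pow₀ hK hi0.ne'

variable {s γ n : ℝ} {φ : E3 → ℝ}

theorem contDiff_bubble (hφ : ContDiff ℝ (⊤ : ℕ∞) φ) : ContDiff ℝ (⊤ : ℕ∞) (bubble s γ φ n) :=
  contDiff_const.mul (hφ.comp (contDiff_const_smul n))

theorem hasCompactSupport_bubble (hφ : HasCompactSupport φ) (hn : n ≠ 0) :
    HasCompactSupport (bubble s γ φ n) :=
  (hφ.comp_smul hn).mul_left

theorem norm_iteratedFDeriv_bubble_le (hφ : ContDiff ℝ (⊤ : ℕ∞) φ)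
    (hφ_supp : tsupport φ ⊆ Metric.closedBall 0 1) (hn : 0 < n)
    (hA : 0 ≤ kap γ n * n ^ ((3 : ℝ) / 2 - s)) {K : ℝ} {i : ℕ}
    (hK : ∀ x, ‖iteratedFDeriv ℝ i φ x‖ ≤ K ^ i) (z : E3) :
    ‖iteratedFDeriv ℝ i (bubble s γ φ n) z‖ ≤ kap γ n * n ^ ((3 : ℝ) / 2 - s) * (K * n) ^ i *
      (Metric.closedBall (0 : E3) n⁻¹).indicator (1 : E3 → ℝ) z := by
  have hi : ContDiff ℝ i φ := hφ.of_le (by exact_mod_cast le_top)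
  have h : iteratedFDeriv ℝ i (bubble s γ φ n) z =
      (kap γ n * n ^ ((3 : ℝ) / 2 - s)) • n ^ i • iteratedFDeriv ℝ i φ (n • z) := by
    have h1 := iteratedFDeriv_const_smul_apply' (a := kap γ n * n ^ ((3 : ℝ) / 2 - s))
      (hi.comp (contDiff_const_smul n)).contDiffAt (x := z)
    have h2 := congrFun (iteratedFDeriv_comp_const_smul n hi) z
    exact h1.trans (congrArg _ h2)
  rw [h, norm_smul, norm_smul, Real.norm_of_nonneg hA, Real.norm_of_nonneg (by positivity)]
  by_cases hz : z ∈ Metric.closedBall (0 : E3) n⁻¹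
  · rw [Set.indicator_of_mem hz, Pi.one_apply, mul_one, mul_pow, mul_comm (K ^ i)]
    gcongr
    exact hK _
  · have hnz : n • z ∉ tsupport φ := fun hmem => hz <| by
      have := hφ_supp hmem
      rw [mem_closedBall_zero_iff, norm_smul, Real.norm_of_nonneg hn.le] at this
      rw [mem_closedBall_zero_iff, ← one_div, le_div_iff₀ hn, mul_comm]
      exact this
    have h0 : iteratedFDeriv ℝ i φ (n • z) = 0 := by
      by_contra hne
      exact hnz (support_iteratedFDeriv_subset i hne)
    rw [h0, Set.indicator_of_notMem hz]
    simp

theorem volume_real_closedBall_inv (hn : 0 < n) :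
    volume.real (Metric.closedBall (0 : E3) n⁻¹) =
      n⁻¹ ^ 3 * volume.real (Metric.closedBall (0 : E3) 1) := by
  rw [Measure.addHaar_real_closedBall' _ _ (inv_nonneg.2 hn.le), finrank_euclideanSpace_fin]

/-- The `L²` norm of the derivatives of the ODE profile, uniformly in the regularization. -/
theorem eLpNorm_pda_vE_le {ρ : E3 → ℝ} (hρ : Integrable ρ) (hρ_nonneg : ∀ x, 0 ≤ ρ x)
    (hρ_int : ∫ x, ρ x = 1) (hφ : ContDiff ℝ (⊤ : ℕ∞) φ)
    (hφ_supp : tsupport φ ⊆ Metric.closedBall 0 1) {N : ℕ} {K : ℝ} (hK1 : 1 ≤ K)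
    (hK : ∀ i ≤ N, ∀ x, ‖iteratedFDeriv ℝ i φ x‖ ≤ K ^ i) (hn : 0 < n)
    (hA : 0 ≤ kap γ n * n ^ ((3 : ℝ) / 2 - s)) {p : ℕ} (hp_odd : Odd p) {ε : ℝ} (hε : 0 < ε)
    {σ t T : ℝ} (hT : |σ * t| * (kap γ n * n ^ ((3 : ℝ) / 2 - s)) ^ (p - 1) ≤ T)
    {α : Fin 3 → ℕ} {k : ℕ} (hα : α 0 + α 1 + α 2 = k) (hk : k ≤ N) :
    eLpNorm (pda α (vE σ p s γ ρ φ n ε t)) 2 volume ≤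
      ENNReal.ofReal (kap γ n * n ^ ((3 : ℝ) / 2 - s) * N.factorial * (p * (K * n) * (1 + T)) ^ k *
        √(n⁻¹ ^ 3 * volume.real (Metric.closedBall (0 : E3) 1))) := by
  set A := kap γ n * n ^ ((3 : ℝ) / 2 - s) with hA_def
  set u := bubbleE s γ ρ φ n ε with hu_def
  set B := Metric.closedBall (0 : E3) n⁻¹ with hB_def
  have hB : MeasurableSet B := Metric.isClosed_closedBall.measurableSet
  have hB' : volume B ≠ ∞ := measure_closedBall_lt_top.ne
  have hφc : HasCompactSupport φ :=
    (isCompact_closedBall (0 : E3) 1).of_isClosed_subset (isClosed_tsupport φ) hφ_supp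
  have hr := integrable_rhoeps hρ hε
  have hr0 := rhoeps_nonneg hρ_nonneg hε
  have hr1 : ∫ x, rhoeps ρ ε x = 1 := (integral_rhoeps ρ hε).trans hρ_int
  set w := kernelMass (rhoeps ρ ε) B with hw_def
  have hw0 : ∀ x, 0 ≤ w x := kernelMass_nonneg hr0 B
  have hw1 : ∀ x, w x ≤ 1 := fun x => (kernelMass_le_integral hr hr0 hB x).trans_eq hr1
  have hu : ContDiff ℝ (⊤ : ℕ∞) u :=
    (hasCompactSupport_bubble hφc hn.ne').contDiff_convolution_right _ hr.locallyIntegrable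
      (contDiff_bubble hφ)
  have hM : 0 ≤ K * n := by positivity
  have hux' : ∀ i ≤ N, ∀ x, ‖iteratedFDeriv ℝ i u x‖ ≤ A * w x * (K * n) ^ i := fun i hi x =>
    (norm_iteratedFDeriv_convolution_le hr hr0 hB i (contDiff_bubble hφ)
      (hasCompactSupport_bubble hφc hn.ne')
      (norm_iteratedFDeriv_bubble_le hφ hφ_supp hn hA (hK i hi)) x).trans_eq (by ring)
  have hux : ∀ i ≤ N, ∀ x, ‖iteratedFDeriv ℝ i u x‖ ≤ A * (K * n) ^ i := fun i hi x =>
    (hux' i hi x).trans <|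
      mul_le_mul_of_nonneg_right (mul_le_of_le_one_right hA (hw1 x)) (pow_nonneg hM i)
  have hp1 : ((p - 1 : ℕ) : ℝ) = (p : ℝ) - 1 := by
    rw [Nat.cast_sub hp_odd.pos, Nat.cast_one]
  have hv : vE σ p s γ ρ φ n ε t = fun y =>
      (u y : ℂ) * Complex.exp (((σ * t * u y ^ (p - 1) : ℝ) : ℂ) * Complex.I) := by
    funext y
    have heven : Even (p - 1) := hp_odd.tsub_odd odd_one
    rw [vE, ← hp1, Real.rpow_natCast, heven.pow_abs]
    congr 2
    push_cast
    ring
  have hvs : ContDiff ℝ (⊤ : ℕ∞) (vE σ p s γ ρ φ n ε t) := by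
    rw [hv]
    exact (Complex.ofRealCLM.contDiff.comp hu).mul
      (contDiff_cexp_ofReal_mul_I.comp (contDiff_const.mul (hu.pow (p - 1))))
  have hT0 : 0 ≤ |σ * t| * A ^ (p - 1) := by positivity
  have hbase : K * n + (1 + |σ * t| * A ^ (p - 1)) * ((p - 1 : ℕ) * (K * n)) ≤
      p * (K * n) * (1 + T) := by
    rw [hp1]
    have hp1' : (0 : ℝ) ≤ p - 1 := hp1 ▸ Nat.cast_nonneg (p - 1)
    calc K * n + (1 + |σ * t| * A ^ (p - 1)) * ((p - 1) * (K * n))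
        ≤ K * n * (1 + T) + (1 + T) * ((p - 1) * (K * n)) := by
          refine add_le_add (le_mul_of_one_le_right hM (by linarith)) ?_
          gcongr
      _ = p * (K * n) * (1 + T) := by ring
  have hpw : ∀ x, ‖pda α (vE σ p s γ ρ φ n ε t) x‖ ≤
      A * N.factorial * (p * (K * n) * (1 + T)) ^ k * w x := by
    intro x
    refine (norm_pda_le hvs α x).trans ?_
    rw [hα, hv]
    refine (norm_iteratedFDeriv_mul_cexp_pow_le hu hA (mul_nonneg hA (hw0 x)) hM
      (fun i hi => hux i hi x) (fun i hi => hux' i hi x) (p - 1) hk).trans ?_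
    calc _ ≤ A * w x * N.factorial * (p * (K * n) * (1 + T)) ^ k := by
          have := hw0 x
          gcongr
      _ = _ := by ring
  have hT' : 0 ≤ T := hT0.trans hT
  refine (eLpNorm_two_le_of_norm_le_mul (by positivity) (integrable_kernelMass hr hB hB')
    hw0 hw1 hpw).trans_eq ?_
  rw [integral_kernelMass hr hB hB', hr1, one_mul, volume_real_closedBall_inv hn]

end Bubbles

section InflationTime

variable {p : ℕ} {s γ β n : ℝ}

theorem lam_sq (hp : 1 ≤ p) (hn : 1 < n) :
    lam p s γ n ^ 2 = (kap γ n * n ^ ((3 : ℝ) / 2 - s)) ^ (p - 1) := by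
  have hn0 : 0 < n := by linarith
  have hκ : 0 ≤ kap γ n := Real.rpow_nonneg (Real.log_pos hn).le _
  have hp1 : ((p - 1 : ℕ) : ℝ) = (p : ℝ) - 1 := by rw [Nat.cast_sub hp, Nat.cast_one]
  rw [lam, mul_pow, mul_pow, ← Real.rpow_natCast (kap γ n) (p - 1),
    ← Real.rpow_natCast (n ^ ((3 : ℝ) / 2 - s)), hp1, ← Real.rpow_mul hn0.le,
    ← Real.rpow_mul_natCast hκ, ← Real.rpow_mul_natCast hn0.le]
  congr 2 <;> push_cast <;> ring

theorem mul_pow_le_log_of_le_tinf (hp : 1 ≤ p) (hn : 1 ≤ Real.log n) (hn1 : 1 < n)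
    (hβ : (β - γ) * ((p : ℝ) - 1) ≤ 1) {t : ℝ} (ht : t ≤ tinf p s γ β n) :
    t * (kap γ n * n ^ ((3 : ℝ) / 2 - s)) ^ (p - 1) ≤ Real.log n := by
  have hκ : 0 < kap γ n := Real.rpow_pos_of_pos (by linarith) _
  have hA : 0 < (kap γ n * n ^ ((3 : ℝ) / 2 - s)) ^ (p - 1) := by
    have := Real.rpow_pos_of_pos (zero_lt_one.trans hn1) ((3 : ℝ) / 2 - s)
    positivity
  rw [tinf, lam_sq hp hn1] at ht
  calc _ ≤ _ := mul_le_mul_of_nonneg_right ht hA.le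
    _ = Real.log n ^ ((β - γ) * ((p : ℝ) - 1)) := by field_simp
    _ ≤ Real.log n ^ (1 : ℝ) := Real.rpow_le_rpow_of_exponent_le hn hβ
    _ = Real.log n := Real.rpow_one _

end InflationTime

/-- In the scaling-supercritical regime `s < s_c = 3/2 - 2/(p-1)`, with
`δ₀ := ((3/2-s)(p-1) - 2)/2 > 0`, there are `C > 0` and `N ≥ 2` such that for all `n ≥ N`,
`ε > 0`, `t ∈ [0, t_n]` and multi-indices `α, α'` with `|α| = 2`, `|α'| = 4`,
`n^s ‖∂^α v_nᵉ(t)‖_{L²} + n^{s-2} ‖∂^{α'} v_nᵉ(t)‖_{L²} ≤ C n^{(3/2-s)(p-1)-δ₀}`. -/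
theorem stmt16
    (σ : ℝ) (hσ : σ = 1 ∨ σ = -1)
    (p : ℕ) (hp_odd : Odd p) (hp : 3 ≤ p)
    (s : ℝ) (hs0 : 0 < s) (hs32 : s < 3 / 2)
    (γ β : ℝ) (hγ0 : 0 < γ) (hγβ : γ < β) (hβ1 : β < 1)
    (hβp : ((p : ℝ) - 1) * β < 1 / 2)
    (hsc : s < 3 / 2 - 2 / ((p : ℝ) - 1))
    (ρ : E3 → ℝ) (hρ_smooth : ContDiff ℝ (⊤ : ℕ∞) ρ) (hρ_supp : HasCompactSupport ρ)
    (hρ_nonneg : ∀ x, 0 ≤ ρ x) (hρ_le : ∀ x, ρ x ≤ 1) (hρ_int : ∫ x, ρ x = 1)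
    (φ : E3 → ℝ) (hφ_smooth : ContDiff ℝ (⊤ : ℕ∞) φ)
    (hφ_supp : tsupport φ ⊆ Metric.closedBall 0 1)
    (hφ_nonneg : ∀ x, 0 ≤ φ x) (hφ_le : ∀ x, φ x ≤ 1) :
    0 < (((3 : ℝ) / 2 - s) * ((p : ℝ) - 1) - 2) / 2 ∧
    ∃ C > 0, ∃ N : ℝ, 2 ≤ N ∧ ∀ n : ℝ, N ≤ n → ∀ ε : ℝ, 0 < ε →
      ∀ t : ℝ, 0 ≤ t → t ≤ tinf p s γ β n →
      ∀ α α' : Fin 3 → ℕ, α 0 + α 1 + α 2 = 2 → α' 0 + α' 1 + α' 2 = 4 →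
      ENNReal.ofReal (n ^ s) * eLpNorm (pda α (vE σ p s γ ρ φ n ε t)) 2 volume +
          ENNReal.ofReal (n ^ (s - 2)) * eLpNorm (pda α' (vE σ p s γ ρ φ n ε t)) 2 volume ≤
        ENNReal.ofReal (C * n ^ (((3 : ℝ) / 2 - s) * ((p : ℝ) - 1) -
          (((3 : ℝ) / 2 - s) * ((p : ℝ) - 1) - 2) / 2)) := by
  have hp1 : (0 : ℝ) < (p : ℝ) - 1 := by
    have : (3 : ℝ) ≤ p := by exact_mod_cast hp
    linarith
  have hδ : 0 < (((3 : ℝ) / 2 - s) * ((p : ℝ) - 1) - 2) / 2 := by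
    have h : 2 / ((p : ℝ) - 1) < 3 / 2 - s := by linarith
    rw [div_lt_iff₀ hp1] at h
    linarith
  refine ⟨hδ, ?_⟩
  set δ := (((3 : ℝ) / 2 - s) * ((p : ℝ) - 1) - 2) / 2 with hδ_def
  have hφc : HasCompactSupport φ :=
    (isCompact_closedBall (0 : E3) 1).of_isClosed_subset (isClosed_tsupport φ) hφ_supp
  obtain ⟨K, hK1, hK⟩ := exists_norm_iteratedFDeriv_le_pow hφ_smooth hφc
    (fun x => by rw [Real.norm_of_nonneg (hφ_nonneg x)]; exact hφ_le x) 4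
  have hρ : Integrable ρ := hρ_smooth.continuous.integrable_of_hasCompactSupport hρ_supp
  set V := volume.real (Metric.closedBall (0 : E3) 1) with hV_def
  have hV : 0 < V :=
    ENNReal.toReal_pos (Metric.measure_closedBall_pos _ _ one_pos).ne'
      measure_closedBall_lt_top.ne
  have hp0 : (0 : ℝ) < p := by linarith
  refine ⟨24 * ((p * K) ^ 2 + (p * K) ^ 4) * √V * (1 + 4 / δ) ^ 4, by positivity, 3, by norm_num,
    fun n hn ε hε t ht0 ht α α' hα hα' => ?_⟩
  have hn0 : 0 < n := by linarith
  have hn1 : 1 < n := by linarith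
  have hlog : 1 ≤ Real.log n := by
    rw [Real.le_log_iff_exp_le hn0]
    linarith [Real.exp_one_lt_d9]
  have hκ0 : 0 < kap γ n := Real.rpow_pos_of_pos (by linarith) _
  have hκ1 : kap γ n ≤ 1 := Real.rpow_le_one_of_one_le_of_nonpos hlog (by linarith)
  have hA : 0 ≤ kap γ n * n ^ ((3 : ℝ) / 2 - s) := by positivity
  have hβγ : (β - γ) * ((p : ℝ) - 1) ≤ 1 := by nlinarith
  have hT : |σ * t| * (kap γ n * n ^ ((3 : ℝ) / 2 - s)) ^ (p - 1) ≤ Real.log n := by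
    have hσ1 : |σ| = 1 := by rcases hσ with rfl | rfl <;> simp
    rw [abs_mul, hσ1, one_mul, abs_of_nonneg ht0]
    exact mul_pow_le_log_of_le_tinf (by omega) hlog hn1 hβγ ht
  have h2 := eLpNorm_pda_vE_le hρ hρ_nonneg hρ_int hφ_smooth hφ_supp hK1 hK hn0 hA hp_odd hε hT
    hα (by norm_num)
  have h4 := eLpNorm_pda_vE_le hρ hρ_nonneg hρ_int hφ_smooth hφ_supp hK1 hK hn0 hA hp_odd hε hT
    hα' le_rfl
  have hsqrt : √(n⁻¹ ^ 3 * V) = n ^ (-(3 / 2) : ℝ) * √V := by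
    rw [Real.sqrt_mul (by positivity), Real.sqrt_eq_rpow (n⁻¹ ^ 3), ← Real.rpow_natCast n⁻¹,
      Real.inv_rpow hn0.le, ← Real.rpow_neg hn0.le, ← Real.rpow_mul hn0.le]
    norm_num
  have hscale : n ^ s * n ^ ((3 : ℝ) / 2 - s) * n ^ (-(3 / 2) : ℝ) = 1 := by
    rw [← Real.rpow_add hn0, ← Real.rpow_add hn0]
    simp
  have hs2 : n ^ (s - 2) = n ^ s / n ^ 2 := by
    rw [Real.rpow_sub hn0, Real.rpow_ofNat]
  have hlogn : 1 + Real.log n ≤ (1 + 4 / δ) * n ^ (δ / 4) := by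
    have h1 : Real.log n ≤ n ^ (δ / 4) / (δ / 4) := Real.log_le_rpow_div hn0.le (by positivity)
    have h3 : 1 ≤ n ^ (δ / 4) := Real.one_le_rpow hn1.le (by positivity)
    calc 1 + Real.log n ≤ n ^ (δ / 4) + n ^ (δ / 4) / (δ / 4) := add_le_add h3 h1
      _ = (1 + 4 / δ) * n ^ (δ / 4) := by field_simp
  have hlog4 : (1 + Real.log n) ^ 4 ≤ (1 + 4 / δ) ^ 4 * n ^ δ := by
    calc (1 + Real.log n) ^ 4 ≤ ((1 + 4 / δ) * n ^ (δ / 4)) ^ 4 := by gcongr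
      _ = (1 + 4 / δ) ^ 4 * n ^ δ := by
        rw [mul_pow, ← Real.rpow_mul_natCast hn0.le]
        congr 2
        push_cast
        ring
  have hlog2 : (1 + Real.log n) ^ 2 ≤ (1 + Real.log n) ^ 4 :=
    pow_le_pow_right₀ (by linarith) (by norm_num)
  have hexp : n ^ (((3 : ℝ) / 2 - s) * ((p : ℝ) - 1) - δ) = n ^ 2 * n ^ δ := by
    rw [← Real.rpow_ofNat, ← Real.rpow_add hn0]
    congr 1
    rw [hδ_def]
    ring
  refine (add_le_add (mul_le_mul_right h2 _) (mul_le_mul_right h4 _)).trans ?_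
  rw [← ENNReal.ofReal_mul (by positivity), ← ENNReal.ofReal_mul (by positivity),
    ← ENNReal.ofReal_add (by positivity) (by positivity)]
  refine ENNReal.ofReal_le_ofReal ?_
  rw [hsqrt, hs2, hexp]
  set L := 1 + Real.log n
  calc _ = kap γ n * (n ^ s * n ^ ((3 : ℝ) / 2 - s) * n ^ (-(3 / 2) : ℝ)) * 24 * √V * n ^ 2 *
        ((p * K) ^ 2 * L ^ 2 + (p * K) ^ 4 * L ^ 4) := by
        simp only [Nat.factorial]
        push_cast
        field_simp
    _ = kap γ n * (24 * √V * n ^ 2 * ((p * K) ^ 2 * L ^ 2 + (p * K) ^ 4 * L ^ 4)) := by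
        rw [hscale]
        ring
    _ ≤ 1 * (24 * √V * n ^ 2 * ((p * K) ^ 2 * L ^ 4 + (p * K) ^ 4 * L ^ 4)) := by
        gcongr
    _ = 24 * ((p * K) ^ 2 + (p * K) ^ 4) * √V * n ^ 2 * L ^ 4 := by ring
    _ ≤ 24 * ((p * K) ^ 2 + (p * K) ^ 4) * √V * n ^ 2 * ((1 + 4 / δ) ^ 4 * n ^ δ) := by gcongr
    _ = _ := by ring
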